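/- arXiv:1207.5184 — 2 statements merged into one kernel-verified Lean document; each statement's English description precedes it below -/
import Mathlib

section
/- Let l ≥ 1, let σ_1, …, σ_l > 0, and let ν be the product Gaussian law on ℝˡ whose j-th coordinate has law N(m_j, σ_j²) (independent components). For every R ≥ 0, the distortion-rate function D(R) of the memoryless vector source with marginal ν, defined as the infimum of all D ≥ 0 such that the pair (R, D) is achievable, equals min { Σ_{j=1}^l σ_j² · 2^(−2ρ_j) : ρ ∈ ℝˡ, ρ_j ≥ 0 for all j, Σ_{j=1}^l ρ_j ≤ R }. (Theorem 2 of the paper: the optimal distortion-rate tradeoff for a Gaussian memoryless vector source with independent components is given by the optimal value of this bit-allocation optimization problem.) -/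
open MeasureTheory ProbabilityTheory

/-- Expected per-vector squared-error distortion of a blocklength-`n` code `(f, g)` with
`M` codewords on an `ℝˡ`-valued source with i.i.d. vector samples of law `ν`. -/
noncomputable def vecExpectedDistortion (l n M : ℕ) (ν : Measure (Fin l → ℝ))
    (f : (Fin n → Fin l → ℝ) → Fin M) (g : Fin M → Fin n → Fin l → ℝ) : ℝ :=
  ∫ x, (1 / (n : ℝ)) * ∑ i, ∑ j, (x i j - g (f x) i j) ^ 2
    ∂(Measure.pi fun _ : Fin n => ν)

/-- A pair `(R, D)` is achievable for the memoryless `ℝˡ`-valued source with marginal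
`ν` if for every `ε > 0` there are a blocklength `n ≥ 1` and a code with at most
`2 ^ (n (R + ε))` codewords whose expected per-vector distortion is at most `D + ε`. -/
def VecIsAchievable (l : ℕ) (ν : Measure (Fin l → ℝ)) (R D : ℝ) : Prop :=
  ∀ ε > (0 : ℝ), ∃ (n M : ℕ) (f : (Fin n → Fin l → ℝ) → Fin M)
    (g : Fin M → Fin n → Fin l → ℝ),
    1 ≤ n ∧ Measurable f ∧ (M : ℝ) ≤ 2 ^ ((n : ℝ) * (R + ε)) ∧
    vecExpectedDistortion l n M ν f g ≤ D + ε

/-- Optimal value of the bit-allocation problem with variances `σⱼ²` and rate budget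
`R`: the minimum of `∑ⱼ σⱼ² 2^(-2ρⱼ)` over `ρ ≥ 0` with `∑ⱼ ρⱼ ≤ R`. -/
noncomputable def bitAllocationValue (l : ℕ) (σ : Fin l → ℝ) (R : ℝ) : ℝ :=
  sInf {d : ℝ | ∃ ρ : Fin l → ℝ, (∀ j, 0 ≤ ρ j) ∧ (∑ j, ρ j) ≤ R ∧
    d = ∑ j, (σ j) ^ 2 * 2 ^ (-(2 * ρ j))}

lemma conv_single (m s θ y τ : ℝ) (hs : 0 < s) (hθ : 0 < θ) (hτ : τ = max s θ) :
    Integrable (fun x => Real.exp ((1/2) * Real.log (τ / θ) + (x - m)^2 / (2*τ) - (x-y)^2 / (2*θ)))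
      (gaussianReal m s.toNNReal) ∧
    ∫ x, Real.exp ((1/2) * Real.log (τ / θ) + (x - m)^2 / (2*τ) - (x-y)^2 / (2*θ))
      ∂(gaussianReal m s.toNNReal) ≤ 1 := by
  have hs' : s.toNNReal ≠ 0 := by simpa using hs
  have hθ' : θ.toNNReal ≠ 0 := by simpa using hθ
  rcases le_total s θ with h | h
  · rw [max_eq_right h] at hτ
    subst hτ
    have key : (fun x => Real.exp ((1/2) * Real.log (τ / τ) + (x - m)^2 / (2*τ) - (x-y)^2 / (2*τ)))
        = fun x => Real.exp ((m^2-y^2)/(2*τ)) * Real.exp ((y-m)/τ * x) := by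
      funext x
      rw [← Real.exp_add, div_self hθ.ne', Real.log_one]
      congr 1
      field_simp
      ring
    rw [key]
    refine ⟨(integrable_exp_mul_gaussianReal _).const_mul _, ?_⟩
    rw [integral_const_mul]
    have := congrFun (mgf_fun_id_gaussianReal (μ := m) (v := s.toNNReal)) ((y-m)/τ)
    simp only [mgf] at this
    rw [this, ← Real.exp_add, Real.exp_le_one_iff, Real.coe_toNNReal _ hs.le]
    have : (m^2-y^2)/(2*τ) + (m * ((y-m)/τ) + s * ((y-m)/τ)^2/2) = - ((y-m)^2 * (τ - s) / (2*τ^2)) := by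
      field_simp
      ring
    rw [this]
    have : 0 ≤ (y-m)^2 * (τ - s) / (2*τ^2) := by
      have : 0 ≤ τ - s := by linarith
      positivity
    linarith
  · rw [max_eq_left h] at hτ
    subst hτ
    have key : ∀ x, gaussianPDFReal m τ.toNNReal x * Real.exp ((1/2) * Real.log (τ / θ) + (x - m)^2 / (2*τ) - (x-y)^2 / (2*θ))
        = gaussianPDFReal y θ.toNNReal x := by
      intro x
      simp only [gaussianPDFReal, Real.coe_toNNReal _ hs.le, Real.coe_toNNReal _ hθ.le]
      have e1 : Real.exp ((1/2) * Real.log (τ / θ)) = √τ / √θ := by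
        rw [← Real.sqrt_div hs.le, ← Real.exp_log (Real.sqrt_pos.2 (div_pos hs hθ)), Real.log_sqrt (div_pos hs hθ).le]
        congr 1; ring
      rw [add_sub_assoc, Real.exp_add, e1, Real.sqrt_mul (by positivity : 0 ≤ 2 * Real.pi) τ, Real.sqrt_mul (by positivity : 0 ≤ 2 * Real.pi) θ]
      have e2 : Real.exp (-(x-y)^2/(2*θ)) = Real.exp (-(x-m)^2/(2*τ)) * Real.exp ((x - m)^2 / (2*τ) - (x-y)^2 / (2*θ)) := by
        rw [← Real.exp_add]; congr 1; ring
      rw [e2]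
      have : √τ ≠ 0 := (Real.sqrt_pos.2 hs).ne'
      have : √θ ≠ 0 := (Real.sqrt_pos.2 hθ).ne'
      field_simp
    constructor
    · rw [gaussianReal_of_var_ne_zero _ hs', gaussianPDF_def,
        integrable_withDensity_iff_integrable_smul' (by fun_prop) (by simp)]
      convert! integrable_gaussianPDFReal y θ.toNNReal using 2 with x
      rw [ENNReal.toReal_ofReal (gaussianPDFReal_nonneg _ _ _), smul_eq_mul, key]
    · rw [integral_gaussianReal_eq_integral_smul hs']
      simp only [smul_eq_mul, key]
      rw [integral_gaussianPDFReal_eq_one _ hθ']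

lemma int_sq_gauss (m : ℝ) (v : NNReal) (y : ℝ) : Integrable (fun x => (x - y)^2) (gaussianReal m v) := by
  have h := (memLp_id_gaussianReal (μ := m) (v := v) 2).sub (memLp_const y)
  exact h.integrable_sq

lemma sq_gauss (m : ℝ) (v : NNReal) : ∫ x, (x-m)^2 ∂(gaussianReal m v) = v := by
  have h := variance_fun_id_gaussianReal (μ := m) (v := v)
  rw [variance_eq_integral (by fun_prop)] at h
  simpa [integral_id_gaussianReal] using h

lemma conv_bound (l n M : ℕ) (hn : 1 ≤ n) (m σ : Fin l → ℝ) (hσ : ∀ j, 0 < σ j) (θ : ℝ) (hθ : 0 < θ)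
    (f : (Fin n → Fin l → ℝ) → Fin M) (g : Fin M → Fin n → Fin l → ℝ) (hf : Measurable f) :
    (n:ℝ) * (∑ j, ((1/2) * Real.log (max (σ j ^2) θ / θ) + σ j ^2 / (2 * max (σ j ^2) θ))
      - vecExpectedDistortion l n M (Measure.pi fun j => gaussianReal (m j) (Real.toNNReal ((σ j) ^ 2))) f g / (2*θ)) ≤ Real.log M := by
  have hM : 0 < M := (f (fun _ _ => 0)).pos
  have hM' : (0:ℝ) < M := by exact_mod_cast hM
  set ν := Measure.pi fun j => gaussianReal (m j) (Real.toNNReal ((σ j) ^ 2)) with hν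
  set μ := Measure.pi fun _ : Fin n => ν with hμ
  have hn' : (0:ℝ) < n := by exact_mod_cast hn
  set τ : Fin l → ℝ := fun j => max (σ j ^2) θ with hτ
  have hτp : ∀ j, 0 < τ j := fun j => lt_of_lt_of_le hθ (le_max_right _ _)
  -- integrability of coordinates
  have hcoord : ∀ (i : Fin n) (j : Fin l) (h : ℝ → ℝ), Integrable h (gaussianReal (m j) (Real.toNNReal ((σ j) ^ 2))) →
      Integrable (fun x : Fin n → Fin l → ℝ => h (x i j)) μ := by
    intro i j h hh
    have h1 : Integrable (fun x : Fin l → ℝ => h (x j)) ν := integrable_comp_eval hh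
    exact integrable_comp_eval (μ := fun _ : Fin n => ν) (i := i) (f := fun x : Fin l → ℝ => h (x j)) h1
  have hcoordI : ∀ (i : Fin n) (j : Fin l) (h : ℝ → ℝ), Integrable h (gaussianReal (m j) (Real.toNNReal ((σ j) ^ 2))) →
      ∫ x, h (x i j) ∂μ = ∫ t, h t ∂(gaussianReal (m j) (Real.toNNReal ((σ j) ^ 2))) := by
    intro i j h hh
    have h1 : Integrable (fun x : Fin l → ℝ => h (x j)) ν := integrable_comp_eval hh
    rw [integral_comp_eval (μ := fun _ : Fin n => ν) (i := i) (f := fun x : Fin l → ℝ => h (x j)) h1.1]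
    exact integral_comp_eval hh.1
  have hgm : ∀ i j, Measurable (fun x => g (f x) i j) := fun i j =>
    (measurable_from_top (f := fun k => g k i j)).comp hf
  have hxm : ∀ i j, Measurable (fun x : Fin n → Fin l → ℝ => x i j) := fun i j => by fun_prop
  have hdist : ∀ i j, Integrable (fun x : Fin n → Fin l → ℝ => (x i j - g (f x) i j)^2) μ := by
    intro i j
    have hb : Integrable (fun x : Fin n → Fin l → ℝ => ∑ k, (x i j - g k i j)^2) μ :=
      integrable_finsetSum _ fun k _ => hcoord i j (fun t => (t - g k i j)^2) (int_sq_gauss _ _ _)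
    refine hb.mono' (((hxm i j).sub (hgm i j)).pow_const 2).aestronglyMeasurable (ae_of_all _ fun x => ?_)
    rw [Real.norm_of_nonneg (sq_nonneg _)]
    exact Finset.single_le_sum (f := fun k => (x i j - g k i j)^2) (fun k _ => sq_nonneg _) (Finset.mem_univ (f x))
  let z : Fin l → ℝ → ℝ := fun j t => (1/2) * Real.log (τ j / θ) + (t - m j)^2 / (2*τ j)
  have hz : ∀ j, Integrable (z j) (gaussianReal (m j) (Real.toNNReal ((σ j) ^ 2))) := fun j =>
    (integrable_const _).add ((int_sq_gauss _ _ _).div_const _)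
  have hzI : ∀ j, ∫ t, z j t ∂(gaussianReal (m j) (Real.toNNReal ((σ j) ^ 2))) = (1/2) * Real.log (τ j / θ) + σ j ^2 / (2 * τ j) := by
    intro j
    simp only [z]
    rw [integral_add (integrable_const _) ((int_sq_gauss _ _ _).div_const _), integral_div, sq_gauss]
    simp [Real.coe_toNNReal _ (sq_nonneg (σ j))]
  let Z : (Fin n → Fin l → ℝ) → ℝ := fun x => ∑ i, ∑ j, (z j (x i j) - (x i j - g (f x) i j)^2/(2*θ))
  have hZint : Integrable Z μ := integrable_finsetSum _ fun i _ => integrable_finsetSum _ fun j _ =>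
    (hcoord i j _ (hz j)).sub ((hdist i j).div_const _)
  have hZI : ∫ x, Z x ∂μ = n * (∑ j, ((1/2) * Real.log (τ j / θ) + σ j ^2 / (2 * τ j)) - vecExpectedDistortion l n M ν f g / (2*θ)) := by
    have hd : vecExpectedDistortion l n M ν f g = (1/n) * ∑ i, ∑ j, ∫ x, (x i j - g (f x) i j)^2 ∂μ := by
      unfold vecExpectedDistortion
      rw [integral_const_mul, integral_finsetSum _ fun i _ => integrable_finsetSum _ fun j _ => hdist i j]
      congr 1
      exact Finset.sum_congr rfl fun i _ => integral_finsetSum _ fun j _ => hdist i j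
    have : ∫ x, Z x ∂μ = ∑ i, ∑ j, (∫ t, z j t ∂(gaussianReal (m j) (Real.toNNReal ((σ j) ^ 2))) - (∫ x, (x i j - g (f x) i j)^2 ∂μ)/(2*θ)) := by
      simp only [Z]
      have hsub : ∀ i j, Integrable (fun x : Fin n → Fin l → ℝ => z j (x i j) - (x i j - g (f x) i j)^2/(2*θ)) μ :=
        fun i j => (hcoord i j _ (hz j)).sub ((hdist i j).div_const _)
      rw [integral_finsetSum _ fun i _ => integrable_finsetSum _ fun j _ => hsub i j]
      refine Finset.sum_congr rfl fun i _ => ?_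
      rw [integral_finsetSum _ fun j _ => hsub i j]
      refine Finset.sum_congr rfl fun j _ => ?_
      rw [integral_sub (hcoord i j _ (hz j)) ((hdist i j).div_const _), hcoordI i j _ (hz j), integral_div]
    rw [this, hd]
    simp only [hzI, Finset.sum_sub_distrib, ← Finset.sum_div]
    simp
    field_simp
  let F : Fin l → ℝ → ℝ → ℝ := fun j y t => Real.exp ((1/2) * Real.log (τ j / θ) + (t - m j)^2 / (2*τ j) - (t-y)^2/(2*θ))
  have hF : ∀ j y, Integrable (F j y) (gaussianReal (m j) (Real.toNNReal ((σ j) ^ 2))) ∧ ∫ t, F j y t ∂(gaussianReal (m j) (Real.toNNReal ((σ j) ^ 2))) ≤ 1 :=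
    fun j y => conv_single (m j) (σ j ^2) θ y (τ j) (pow_pos (hσ j) 2) hθ rfl
  have hFp : ∀ j y t, 0 ≤ F j y t := fun j y t => (Real.exp_pos _).le
  let W : Fin M → (Fin n → Fin l → ℝ) → ℝ := fun k x => ∏ i, ∏ j, F j (g k i j) (x i j)
  have hWint : ∀ k, Integrable (W k) μ := fun k =>
    Integrable.fintype_prod (f := fun i (x : Fin l → ℝ) => ∏ j, F j (g k i j) (x j)) fun i =>
      Integrable.fintype_prod (f := fun j => F j (g k i j)) fun j => (hF j _).1
  have hWI : ∀ k, ∫ x, W k x ∂μ ≤ 1 := by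
    intro k
    simp only [W]
    rw [integral_fintype_prod_eq_prod (fun i (x : Fin l → ℝ) => ∏ j, F j (g k i j) (x j))]
    have : ∀ i, ∫ x, ∏ j, F j (g k i j) (x j) ∂ν = ∏ j, ∫ t, F j (g k i j) t ∂(gaussianReal (m j) (Real.toNNReal ((σ j) ^ 2))) := fun i =>
      integral_fintype_prod_eq_prod _
    simp only [this]
    refine Finset.prod_le_one (fun i _ => Finset.prod_nonneg fun j _ => integral_nonneg fun t => hFp _ _ _) fun i _ =>
      Finset.prod_le_one (fun j _ => integral_nonneg fun t => hFp _ _ _) fun j _ => (hF j _).2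
  have hZW : ∀ x, Real.exp (Z x) ≤ ∑ k, W k x := by
    intro x
    have : Real.exp (Z x) = W (f x) x := by
      simp only [Z, W, F, z, Real.exp_sum]
    rw [this]
    exact Finset.single_le_sum (f := fun k => W k x) (fun k _ => Finset.prod_nonneg fun i _ => Finset.prod_nonneg fun j _ => hFp _ _ _) (Finset.mem_univ (f x))
  have hpt : ∀ x, Z x ≤ Real.log M - 1 + (∑ k, W k x) / M := by
    intro x
    have h1 := Real.add_one_le_exp (Z x - Real.log M)
    rw [Real.exp_sub, Real.exp_log hM'] at h1
    have := div_le_div_of_nonneg_right (hZW x) hM'.le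
    linarith
  have hS : Integrable (fun x => ∑ k, W k x) μ := integrable_finsetSum _ fun k _ => hWint k
  have := integral_mono hZint ((integrable_const _).add (hS.div_const _)) hpt
  rw [hZI] at this
  simp only [Pi.add_apply] at this
  rw [integral_add (integrable_const _) (hS.div_const _), integral_div, integral_finsetSum _ fun k _ => hWint k] at this
  have h2 : (∑ k, ∫ x, W k x ∂μ) / M ≤ 1 := by
    rw [div_le_one hM']
    calc _ ≤ ∑ k : Fin M, (1:ℝ) := Finset.sum_le_sum fun k _ => hWI k
      _ = M := by simp
  simp at this
  linarith

lemma wlln_bound {Ω : Type*} [MeasurableSpace Ω] (μ : Measure Ω) [IsProbabilityMeasure μ] (h : Ω → ℝ)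
    (hh : MemLp h 2 μ) (δ : ℝ) (hδ : 0 < δ) (n : ℕ) (hn : 1 ≤ n) :
    (Measure.pi fun _ : Fin n => μ).real {ω | n * (∫ x, h x ∂μ + δ) < ∑ i, h (ω i)} ≤ (variance h μ / δ^2) / n := by
  have hn' : (0:ℝ) < n := by exact_mod_cast hn
  have hL : MemLp (∑ i : Fin n, fun ω : Fin n → Ω => h (ω i)) 2 (Measure.pi fun _ : Fin n => μ) :=
    memLp_finsetSum' _ fun i _ => hh.comp_measurePreserving (measurePreserving_eval (fun _ : Fin n => μ) i)
  have hc : 0 < n * δ := by positivity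
  have h1 := meas_ge_le_variance_div_sq hL hc
  rw [variance_sum_pi (X := fun _ => h) (fun _ => hh)] at h1
  have hE : ∫ ω, (∑ i : Fin n, fun ω : Fin n → Ω => h (ω i)) ω ∂(Measure.pi fun _ : Fin n => μ) = n * ∫ x, h x ∂μ := by
    simp only [Finset.sum_apply]
    rw [integral_finsetSum _ fun i _ => integrable_comp_eval (μ := fun _ : Fin n => μ) (i := i) (hh.integrable (by norm_num))]
    simp [integral_comp_eval (μ := fun _ : Fin n => μ) hh.1]
  rw [hE] at h1
  have h2 : (Measure.pi fun _ : Fin n => μ) {ω | n * (∫ x, h x ∂μ + δ) < ∑ i, h (ω i)} ≤ ENNReal.ofReal ((variance h μ / δ^2) / n) := by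
    refine (measure_mono ?_).trans (h1.trans (ENNReal.ofReal_le_ofReal (le_of_eq ?_)))
    · intro ω hω
      simp only [Set.mem_ofPred_eq, Finset.sum_apply] at hω ⊢
      refine le_trans ?_ (le_abs_self _)
      linarith
    · simp
      field_simp
  exact ENNReal.toReal_le_of_le_ofReal (div_nonneg (div_nonneg (variance_nonneg _ _) (by positivity)) hn'.le) h2

lemma real_cover (q w γ : ℝ) (M : ℕ) (hγ : 0 < γ) (hq1 : q ≤ 1) (hw : 0 ≤ w) (hw1 : w ≤ 1) (hwq : w ≤ γ * q) :
    (1 - q)^M ≤ 1 - w + Real.exp (-(M/γ)) := by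
  have h1 : (1-q)^M ≤ Real.exp (-(M * q)) := by
    calc (1-q)^M ≤ (Real.exp (-q))^M := pow_le_pow_left₀ (by linarith) (by linarith [Real.add_one_le_exp (-q)]) _
      _ = _ := by rw [← Real.exp_nat_mul]; congr 1; ring
  have h2 : Real.exp (-(M*q)) ≤ Real.exp ((1-w) * 0 + w * (-(M/γ))) := by
    apply Real.exp_le_exp.2
    have : w / γ ≤ q := by rw [div_le_iff₀ hγ]; linarith
    have := mul_le_mul_of_nonneg_left this (Nat.cast_nonneg (α := ℝ) M)
    have e : w * (-(M/γ)) = - (M * (w/γ)) := by ring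
    linarith
  have h3 := convexOn_exp.2 (Set.mem_univ (0:ℝ)) (Set.mem_univ (-(M/γ):ℝ)) (by linarith : 0 ≤ 1 - w) hw (by ring)
  simp only [smul_eq_mul, Real.exp_zero] at h3
  have h4 : w * Real.exp (-(M/γ)) ≤ Real.exp (-(M/γ)) := by
    nlinarith [Real.exp_pos (-(M/γ))]
  linarith

lemma one_shot {X Y : Type*} [MeasurableSpace X] [MeasurableSpace Y] (P : Measure X) [IsProbabilityMeasure P]
    (Q : Measure Y) [IsProbabilityMeasure Q] (G : Set (X × Y)) (hG : MeasurableSet G) (w : X → ℝ) (hwm : Measurable w)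
    (γ η : ℝ) (hγ : 0 < γ) (hw0 : ∀ x, 0 ≤ w x) (hw1 : ∀ x, w x ≤ 1)
    (hwq : ∀ x, w x ≤ γ * Q.real {y | (x, y) ∈ G}) (hη : 1 - η ≤ ∫ x, w x ∂P) (M : ℕ) :
    ∃ y : Fin M → Y, P.real {x | ∀ k, (x, y k) ∉ G} ≤ η + Real.exp (-(M/γ)) := by
  let QM := Measure.pi fun _ : Fin M => Q
  let B : Set ((Fin M → Y) × X) := {p | ∀ k, (p.2, p.1 k) ∉ G}
  have hB : MeasurableSet B := by
    have : B = ⋂ k, (fun p : (Fin M → Y) × X => (p.2, p.1 k)) ⁻¹' Gᶜ := by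
      ext p; simp [B]
    rw [this]
    exact MeasurableSet.iInter fun k => (by fun_prop : Measurable fun p : (Fin M → Y) × X => (p.2, p.1 k)) hG.compl
  obtain ⟨y, hy⟩ := exists_le_lintegral (μ := QM) (f := fun y => P {x | (y, x) ∈ B})
    (measurable_measure_prodMk_left hB).aemeasurable
  refine ⟨y, ?_⟩
  have e1 : ∫⁻ y, P {x | (y,x) ∈ B} ∂QM = ∫⁻ x, QM {y | (y,x) ∈ B} ∂P := by
    exact (Measure.prod_apply (μ := QM) (ν := P) hB).symm.trans (Measure.prod_apply_symm (μ := QM) (ν := P) hB)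
  have hwi : Integrable w P := by
    refine Integrable.of_bound hwm.aestronglyMeasurable 1 (ae_of_all _ fun x => ?_)
    rw [Real.norm_of_nonneg (hw0 x)]; exact hw1 x
  have e2 : ∀ x, QM {y | (y,x) ∈ B} ≤ ENNReal.ofReal (1 - w x + Real.exp (-(M/γ))) := by
    intro x
    have hGx : MeasurableSet {y | (x,y) ∈ G} := measurable_prodMk_left hG
    have : {y : Fin M → Y | (y,x) ∈ B} = Set.univ.pi fun _ => {y | (x,y) ∈ G}ᶜ := by
      ext y; simp [B]
    rw [this, Measure.pi_pi]
    have hc : Q {y | (x,y) ∈ G}ᶜ = ENNReal.ofReal (1 - Q.real {y | (x,y) ∈ G}) := by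
      rw [← probReal_compl_eq_one_sub hGx, ofReal_measureReal]
    simp only [hc, Finset.prod_const, Finset.card_univ, Fintype.card_fin]
    rw [← ENNReal.ofReal_pow (by linarith [measureReal_le_one (μ := Q) (s := {y | (x,y) ∈ G})])]
    exact ENNReal.ofReal_le_ofReal (real_cover _ _ _ _ hγ measureReal_le_one (hw0 x) (hw1 x) (hwq x))
  have hint : Integrable (fun x => 1 - w x + Real.exp (-(M/γ))) P := ((integrable_const _).sub hwi).add (integrable_const _)
  have e3 : P {x | (y,x) ∈ B} ≤ ENNReal.ofReal (1 - ∫ x, w x ∂P + Real.exp (-(M/γ))) := by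
    refine (hy.trans (e1.le.trans (lintegral_mono e2))).trans (le_of_eq ?_)
    rw [← ofReal_integral_eq_lintegral_ofReal hint (ae_of_all _ fun x => by
      have := hw1 x; have := Real.exp_pos (-(M/γ)); simp only [Pi.zero_apply]; linarith)]
    congr 1
    have hsub : Integrable (fun x => 1 - w x) P := (integrable_const _).sub hwi
    rw [integral_add hsub (integrable_const _), integral_sub (integrable_const _) hwi]
    simp
  have hle : ∫ x, w x ∂P ≤ 1 := by
    have := integral_mono hwi (integrable_const (1:ℝ)) hw1
    simpa using this
  have := ENNReal.toReal_le_of_le_ofReal (by linarith [Real.exp_pos (-(M/γ))]) e3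
  change P.real {x | (y,x) ∈ B} ≤ _
  rw [measureReal_def]
  linarith

lemma pi_withDensity_ofReal {n : ℕ} (Q : Measure ℝ) [IsProbabilityMeasure Q] (k : Fin n → ℝ → ℝ)
    (hk : ∀ i t, 0 ≤ k i t) (hki : ∀ i, Integrable (k i) Q) :
    Measure.pi (fun i => Q.withDensity fun t => ENNReal.ofReal (k i t)) =
      (Measure.pi fun _ : Fin n => Q).withDensity fun y => ENNReal.ofReal (∏ i, k i (y i)) := by
  have : ∀ i, IsFiniteMeasure (Q.withDensity fun t => ENNReal.ofReal (k i t)) := fun i =>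
    isFiniteMeasure_withDensity_ofReal (hki i).2
  refine Measure.pi_eq fun s hs => ?_
  rw [withDensity_apply _ (MeasurableSet.univ_pi hs), Measure.restrict_pi_pi]
  have hI : Integrable (fun y : Fin n → ℝ => ∏ i, k i (y i)) (Measure.pi fun i => Q.restrict (s i)) :=
    Integrable.fintype_prod fun i => (hki i).restrict
  rw [← ofReal_integral_eq_lintegral_ofReal hI (ae_of_all _ fun y => Finset.prod_nonneg fun i _ => hk _ _),
    integral_fintype_prod_eq_prod, ENNReal.ofReal_prod_of_nonneg fun i _ => integral_nonneg fun t => hk _ _]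
  refine Finset.prod_congr rfl fun i _ => ?_
  rw [withDensity_apply _ (hs i), ofReal_integral_eq_lintegral_ofReal (hki i).restrict (ae_of_all _ fun y => hk _ _)]

/-- log density -/
noncomputable def ldens (s r x y : ℝ) : ℝ := r - (x-y)^2/(2*(s*Real.exp (-(2*r)))) + x^2/(2*s)

lemma channel_density (s r x : ℝ) (hs : 0 < s) (hr : 0 < r) :
    gaussianReal ((1 - Real.exp (-(2*r))) * x) (Real.toNNReal (s * Real.exp (-(2*r)) * (1 - Real.exp (-(2*r))))) =
    (gaussianReal 0 (Real.toNNReal (s * (1 - Real.exp (-(2*r)))))).withDensity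
      fun y => ENNReal.ofReal (Real.exp (ldens s r x y)) := by
  have he : Real.exp (-(2*r)) < 1 := Real.exp_lt_one_iff.2 (by linarith)
  have he0 := Real.exp_pos (-(2*r))
  have hrr : Real.exp r = 1 / √(Real.exp (-(2*r))) := by
    rw [Real.sqrt_eq_rpow, ← Real.exp_mul, one_div, ← Real.exp_neg]; congr 1; ring
  unfold ldens
  generalize Real.exp (-(2*r)) = e at *
  have h1 : 0 < 1 - e := by linarith
  have p1 : 0 < s * e * (1-e) := by positivity
  have p2 : 0 < s * (1-e) := by positivity
  rw [gaussianReal_of_var_ne_zero _ (by simpa using p1), gaussianReal_of_var_ne_zero _ (by simpa using p2),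
    ← withDensity_mul _ (by fun_prop) (by fun_prop)]
  congr 1
  funext y
  simp only [Pi.mul_apply, gaussianPDF]
  rw [← ENNReal.ofReal_mul (gaussianPDFReal_nonneg _ _ _)]
  congr 1
  simp only [gaussianPDFReal, Real.coe_toNNReal _ p1.le, Real.coe_toNNReal _ p2.le]
  rw [sub_add_eq_add_sub, add_sub_assoc, Real.exp_add, hrr]
  have e2 : Real.exp (-(y - (1-e)*x)^2/(2*(s*e*(1-e)))) = Real.exp (-(y-0)^2/(2*(s*(1-e)))) * Real.exp (x^2/(2*s) - (x-y)^2/(2*(s*e))) := by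
    rw [← Real.exp_add]; congr 1
    field_simp
    ring
  rw [e2]
  have e3 : √(2*Real.pi*(s*e*(1-e))) = √(2*Real.pi*(s*(1-e))) * √e := by
    rw [← Real.sqrt_mul (by positivity)]; congr 1; ring
  rw [e3]
  have : √e ≠ 0 := (Real.sqrt_pos.2 he0).ne'
  have : √(2*Real.pi*(s*(1-e))) ≠ 0 := (Real.sqrt_pos.2 (by positivity)).ne'
  field_simp

lemma sq_memLp {Ω : Type*} [MeasurableSpace Ω] {μ : Measure Ω} [IsFiniteMeasure μ] {f : Ω → ℝ} (hf : MemLp f 4 μ) :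
    MemLp (fun x => f x ^ 2) 2 μ := by
  refine (memLp_two_iff_integrable_sq (f := fun x => f x ^ 2) (hf.1.pow 2)).2 ?_
  have := hf.integrable_norm_pow (p := 4) (by norm_num)
  refine this.congr (ae_of_all _ fun x => ?_)
  simp only [Real.norm_eq_abs]
  rw [← sq_abs (f x)]
  ring

lemma prod_quad (v1 v2 : NNReal) (a b : ℝ) :
    MemLp (fun p : ℝ × ℝ => (a * p.1 + b * p.2)^2) 2 ((gaussianReal 0 v1).prod (gaussianReal 0 v2)) ∧
    ∫ p, (a * p.1 + b * p.2)^2 ∂((gaussianReal 0 v1).prod (gaussianReal 0 v2)) = a^2 * v1 + b^2 * v2 := by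
  have m1 : ∀ q : NNReal, MemLp (fun p : ℝ × ℝ => p.1) q ((gaussianReal 0 v1).prod (gaussianReal 0 v2)) := fun q =>
    (memLp_id_gaussianReal (μ := 0) (v := v1) q).comp_measurePreserving measurePreserving_fst
  have m2 : ∀ q : NNReal, MemLp (fun p : ℝ × ℝ => p.2) q ((gaussianReal 0 v1).prod (gaussianReal 0 v2)) := fun q =>
    (memLp_id_gaussianReal (μ := 0) (v := v2) q).comp_measurePreserving measurePreserving_snd
  refine ⟨sq_memLp ?_, ?_⟩
  · exact ((m1 4).const_mul a).add ((m2 4).const_mul b)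
  · have i1 := (m1 2).integrable_sq
    have i2 := (m2 2).integrable_sq
    have i3 : Integrable (fun p : ℝ × ℝ => p.1 * p.2) ((gaussianReal 0 v1).prod (gaussianReal 0 v2)) :=
      MemLp.integrable_mul (p := 2) (q := 2) (m1 2) (m2 2)
    have e1 : ∫ p : ℝ × ℝ, p.1^2 ∂((gaussianReal 0 v1).prod (gaussianReal 0 v2)) = v1 := by
      have := integral_prod_mul (μ := gaussianReal 0 v1) (ν := gaussianReal 0 v2) (fun x => x^2) (fun _ => (1:ℝ))
      have h := sq_gauss 0 v1
      simp only [sub_zero] at h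
      simpa [h] using this
    have e2 : ∫ p : ℝ × ℝ, p.2^2 ∂((gaussianReal 0 v1).prod (gaussianReal 0 v2)) = v2 := by
      have := integral_prod_mul (μ := gaussianReal 0 v1) (ν := gaussianReal 0 v2) (fun _ => (1:ℝ)) (fun x => x^2)
      have h := sq_gauss 0 v2
      simp only [sub_zero] at h
      simpa [h] using this
    have e3 : ∫ p : ℝ × ℝ, p.1 * p.2 ∂((gaussianReal 0 v1).prod (gaussianReal 0 v2)) = 0 := by
      have := integral_prod_mul (μ := gaussianReal 0 v1) (ν := gaussianReal 0 v2) (fun x => x) (fun x => x)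
      simpa [integral_id_gaussianReal] using this
    have : ∀ p : ℝ × ℝ, (a * p.1 + b * p.2)^2 = (a^2 * p.1^2 + b^2 * p.2^2) + (2*a*b) * (p.1*p.2) := fun p => by ring
    simp only [this]
    have i4 : Integrable (fun p : ℝ × ℝ => a^2 * p.1^2 + b^2 * p.2^2) ((gaussianReal 0 v1).prod (gaussianReal 0 v2)) :=
      (i1.const_mul _).add (i2.const_mul _)
    rw [integral_add i4 (i3.const_mul _), integral_add (i1.const_mul _) (i2.const_mul _),
      integral_const_mul, integral_const_mul, integral_const_mul, e1, e2, e3]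
    ring

lemma cover (s r δ : ℝ) (hs : 0 < s) (hr : 0 < r) (hδ : 0 < δ) : ∃ K : ℝ, ∀ n : ℕ, 1 ≤ n → ∀ M : ℕ,
    ∃ y : Fin M → Fin n → ℝ, (Measure.pi fun _ : Fin n => gaussianReal 0 s.toNNReal).real
      {x | ∀ k, ¬ (∑ i, (x i - y k i)^2 ≤ n * (s * Real.exp (-(2*r)) + δ))} ≤
        K / n + Real.exp (-(M / Real.exp (n * (r + δ)))) := by
  set e := Real.exp (-(2*r)) with he_def
  have he : e < 1 := Real.exp_lt_one_iff.2 (by linarith)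
  have he0 : 0 < e := Real.exp_pos _
  have h1e : 0 < 1 - e := by linarith
  set P := gaussianReal 0 s.toNNReal with hP
  set V := gaussianReal 0 (Real.toNNReal (s * e * (1-e))) with hV
  set Q := gaussianReal 0 (Real.toNNReal (s * (1-e))) with hQ
  let h1 : ℝ × ℝ → ℝ := fun p => (p.1 - ((1-e) * p.1 + p.2))^2
  let h2 : ℝ × ℝ → ℝ := fun p => ldens s r p.1 ((1-e)*p.1 + p.2)
  have q1 := prod_quad s.toNNReal (Real.toNNReal (s * e * (1-e))) e (-1)
  have q2 := prod_quad s.toNNReal (Real.toNNReal (s * e * (1-e))) 1 0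
  rw [Real.coe_toNNReal _ hs.le, Real.coe_toNNReal _ (by positivity)] at q1 q2
  have h1eq : h1 = fun p => (e * p.1 + (-1) * p.2)^2 := by funext p; simp only [h1]; ring
  have h1L : MemLp h1 2 (P.prod V) := by rw [h1eq]; exact q1.1
  have h1E : ∫ p, h1 p ∂(P.prod V) = s * e := by rw [h1eq, q1.2]; ring
  have h2eq : h2 = fun p => (r - h1 p / (2*(s*e))) + (1 * p.1 + 0 * p.2)^2/(2*s) := by
    funext p; simp only [h2, h1, ldens]; rw [← he_def]; ring
  have d1 : MemLp (fun p => h1 p / (2*(s*e))) 2 (P.prod V) := by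
    simpa [div_eq_mul_inv] using h1L.mul_const (2*(s*e))⁻¹
  have d2 : MemLp (fun p : ℝ × ℝ => (1 * p.1 + 0 * p.2)^2/(2*s)) 2 (P.prod V) := by
    simpa only [div_eq_mul_inv] using q2.1.mul_const (2*s)⁻¹
  have d3 : MemLp (fun p => r - h1 p / (2*(s*e))) 2 (P.prod V) := (memLp_const r).sub d1
  have h2L : MemLp h2 2 (P.prod V) := by
    rw [h2eq]
    exact d3.add d2
  have h2E : ∫ p, h2 p ∂(P.prod V) = r := by
    rw [h2eq, integral_add (d3.integrable (by norm_num)) (d2.integrable (by norm_num)),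
      integral_sub (integrable_const _) (d1.integrable (by norm_num)), integral_div, integral_div, h1E, q2.2]
    simp
    field_simp
    ring
  refine ⟨variance h1 (P.prod V) / δ^2 + variance h2 (P.prod V) / δ^2, fun n hn M => ?_⟩
  let G : Set ((Fin n → ℝ) × (Fin n → ℝ)) := {p | ∑ i, (p.1 i - p.2 i)^2 ≤ n * (s * e + δ)} ∩
    {p | ∑ i, ldens s r (p.1 i) (p.2 i) ≤ n * (r + δ)}
  have hG : MeasurableSet G := by
    apply MeasurableSet.inter
    · exact measurableSet_le (by fun_prop) measurable_const
    · exact measurableSet_le (by unfold ldens; fun_prop) measurable_const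
  let T : (Fin n → ℝ) × (Fin n → ℝ) → (Fin n → ℝ) × (Fin n → ℝ) := fun p => (p.1, fun i => (1-e) * p.1 i + p.2 i)
  have hT : Measurable T := by fun_prop
  let Pn := Measure.pi fun _ : Fin n => P
  let Vn := Measure.pi fun _ : Fin n => V
  let Qn := Measure.pi fun _ : Fin n => Q
  let w : (Fin n → ℝ) → ℝ := fun x => Vn.real {v | (x, v) ∈ T ⁻¹' G}
  have hTG : MeasurableSet (T ⁻¹' G) := hT hG
  have hwm : Measurable w := (measurable_measure_prodMk_left (ν := Vn) hTG).ennreal_toReal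
  have hwP : ∫ x, w x ∂Pn = (Pn.prod Vn).real (T ⁻¹' G) := by
    rw [measureReal_def, Measure.prod_apply hTG]
    simp only [w, measureReal_def]
    exact integral_toReal (measurable_measure_prodMk_left hTG).aemeasurable (ae_of_all _ fun x => measure_lt_top _ _)
  have hbig : 1 - (variance h1 (P.prod V) / δ^2 + variance h2 (P.prod V) / δ^2) / n ≤ ∫ x, w x ∂Pn := by
    rw [hwP]
    have mp := measurePreserving_arrowProdEquivProdArrow ℝ ℝ (Fin n) (fun _ => P) (fun _ => V)
    have e1 : (Pn.prod Vn).real (T ⁻¹' G)ᶜ ≤ (variance h1 (P.prod V) / δ^2 + variance h2 (P.prod V) / δ^2) / n := by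
      have : (Pn.prod Vn).real (T ⁻¹' G)ᶜ = (Measure.pi fun _ : Fin n => P.prod V).real ((MeasurableEquiv.arrowProdEquivProdArrow ℝ ℝ (Fin n)) ⁻¹' (T ⁻¹' G)ᶜ) := by
        rw [measureReal_def, measureReal_def, mp.measure_preimage hTG.compl.nullMeasurableSet]
      rw [this, add_div]
      refine le_trans ?_ (add_le_add (wlln_bound (P.prod V) h1 h1L δ hδ n hn) (wlln_bound (P.prod V) h2 h2L δ hδ n hn))
      refine le_trans (measureReal_mono ?_) (measureReal_union_le _ _)
      intro ω hω
      rw [h1E, h2E]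
      by_contra hcon
      simp only [Set.mem_union, Set.mem_ofPred_eq, not_or, not_lt] at hcon
      exact hω ⟨hcon.1, hcon.2⟩
    rw [probReal_compl_eq_one_sub hTG] at e1
    linarith
  have hwq : ∀ x, w x ≤ Real.exp (n * (r + δ)) * Qn.real {y | (x, y) ∈ G} := by
    intro x
    have hGx : MeasurableSet {y | (x, y) ∈ G} := measurable_prodMk_left hG
    have map1 : Vn.map (fun v i => (1-e) * x i + v i) = Measure.pi fun i => gaussianReal ((1-e) * x i) (Real.toNNReal (s * e * (1-e))) := by
      have hm : ∀ i : Fin n, V.map (fun t => (1-e) * x i + t) = gaussianReal ((1-e) * x i) (Real.toNNReal (s * e * (1-e))) := by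
        intro i
        rw [hV, gaussianReal_map_const_add, zero_add]
      have : ∀ i : Fin n, SigmaFinite (V.map (fun t => (1-e) * x i + t)) := fun i => by rw [hm i]; infer_instance
      rw [Measure.pi_map_pi (μ := fun _ : Fin n => V) (f := fun i t => (1-e) * x i + t) (fun i => by fun_prop)]
      simp only [hm]
    have hki : ∀ i : Fin n, Integrable (fun y => Real.exp (ldens s r (x i) y)) Q := by
      intro i
      refine ⟨by unfold ldens; fun_prop, ?_⟩
      rw [hasFiniteIntegral_iff_ofReal (ae_of_all _ fun y => (Real.exp_pos _).le)]
      have := channel_density s r (x i) hs hr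
      rw [← setLIntegral_univ, ← withDensity_apply _ MeasurableSet.univ, ← this]
      exact measure_lt_top _ _
    have e1 : Vn {v | (x, v) ∈ T ⁻¹' G} = ∫⁻ y in {y | (x, y) ∈ G}, ENNReal.ofReal (∏ i, Real.exp (ldens s r (x i) (y i))) ∂Qn := by
      rw [← withDensity_apply _ hGx, ← pi_withDensity_ofReal Q (fun i y => Real.exp (ldens s r (x i) y)) (fun i t => (Real.exp_pos _).le) hki]
      have : (fun i => Q.withDensity fun t => ENNReal.ofReal (Real.exp (ldens s r (x i) t))) = fun i => gaussianReal ((1-e) * x i) (Real.toNNReal (s * e * (1-e))) := by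
        funext i
        exact (channel_density s r (x i) hs hr).symm
      rw [this, ← map1, Measure.map_apply (by fun_prop) hGx]
      rfl
    have e2 : Vn {v | (x, v) ∈ T ⁻¹' G} ≤ ENNReal.ofReal (Real.exp (n * (r + δ))) * Qn {y | (x, y) ∈ G} := by
      rw [e1, ← setLIntegral_const]
      refine setLIntegral_mono measurable_const fun y hy => ?_
      apply ENNReal.ofReal_le_ofReal
      rw [← Real.exp_sum]
      exact Real.exp_le_exp.2 hy.2
    have := ENNReal.toReal_mono (ENNReal.mul_ne_top ENNReal.ofReal_ne_top (measure_ne_top _ _)) e2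
    rw [ENNReal.toReal_mul, ENNReal.toReal_ofReal (Real.exp_pos _).le] at this
    exact this
  obtain ⟨y, hy⟩ := one_shot Pn Qn G hG w hwm (Real.exp (n * (r + δ))) _ (Real.exp_pos _) (fun x => measureReal_nonneg)
    (fun x => measureReal_le_one) hwq hbig M
  refine ⟨y, le_trans (measureReal_mono ?_) hy⟩
  intro x hx k hk
  exact hx k hk.1

lemma code_of_cover (s : ℝ) (n Mc : ℕ) (hn : 1 ≤ n) (d p T : ℝ) (hT : 0 < T) (hd : 0 ≤ d)
    (y : Fin Mc → Fin n → ℝ)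
    (hy : (Measure.pi fun _ : Fin n => gaussianReal 0 s.toNNReal).real {x | ∀ k, ¬ (∑ i, (x i - y k i)^2 ≤ n * d)} ≤ p) :
    ∃ (f : (Fin n → ℝ) → Fin (Mc+1)) (g : Fin (Mc+1) → Fin n → ℝ), Measurable f ∧
      ∫ x, (1/(n:ℝ)) * ∑ i, (x i - g (f x) i)^2 ∂(Measure.pi fun _ : Fin n => gaussianReal 0 s.toNNReal) ≤
        d + T * p + (∫ t, t^4 ∂(gaussianReal 0 s.toNNReal)) / T := by
  classical
  have hn' : (0:ℝ) < n := by exact_mod_cast hn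
  let q : (Fin n → ℝ) → ℕ → Prop := fun x k => (∃ h : k < Mc, ∑ i, (x i - y ⟨k,h⟩ i)^2 ≤ n * d) ∨ k = Mc
  have hq : ∀ x, ∃ k, q x k := fun x => ⟨Mc, Or.inr rfl⟩
  have hqm : ∀ k, MeasurableSet {x | q x k} := by
    intro k
    by_cases hk : k < Mc
    · have : {x | q x k} = {x | ∑ i, (x i - y ⟨k,hk⟩ i)^2 ≤ n * d} := by
        ext x
        simp [q, hk, hk.ne]
      rw [this]
      exact measurableSet_le (by fun_prop) measurable_const
    · by_cases hk2 : k = Mc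
      · have : {x | q x k} = Set.univ := by
          ext x; simp [q, hk2]
        rw [this]; exact MeasurableSet.univ
      · have : {x | q x k} = ∅ := by
          ext x; simp [q, hk2, hk]
        rw [this]; exact MeasurableSet.empty
  have hfm := measurable_find hq hqm
  let f : (Fin n → ℝ) → Fin (Mc+1) := fun x => Fin.ofNat (Mc+1) (Nat.find (hq x))
  let g : Fin (Mc+1) → Fin n → ℝ := fun k => if h : (k:ℕ) < Mc then y ⟨k,h⟩ else 0
  have hfv : ∀ x, ((f x : Fin (Mc+1)) : ℕ) = Nat.find (hq x) := by
    intro x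
    have : Nat.find (hq x) ≤ Mc := Nat.find_min' (hq x) (Or.inr rfl)
    simp only [f, Fin.val_ofNat]
    exact Nat.mod_eq_of_lt (by omega)
  set μ := Measure.pi fun _ : Fin n => gaussianReal 0 s.toNNReal with hμ
  set F : Set (Fin n → ℝ) := {x | ∀ k, ¬ (∑ i, (x i - y k i)^2 ≤ n * d)} with hF
  have hFm : MeasurableSet F := by
    have : F = ⋂ k, {x | ∑ i, (x i - y k i)^2 ≤ n * d}ᶜ := by
      ext x; simp [hF]
    rw [this]
    exact MeasurableSet.iInter fun k => (measurableSet_le (by fun_prop) measurable_const).compl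
  have i4 : Integrable (fun t : ℝ => t^4) (gaussianReal 0 s.toNNReal) := by
    have := (memLp_id_gaussianReal (μ := 0) (v := s.toNNReal) 4).integrable_norm_pow (p := 4) (by norm_num)
    refine this.congr (ae_of_all _ fun x => ?_)
    simp only [Real.norm_eq_abs, id]
    exact Even.pow_abs (by decide) x
  refine ⟨f, g, (measurable_from_top (f := fun k => Fin.ofNat (Mc+1) k)).comp hfm, ?_⟩
  have hpt : ∀ x, (1/(n:ℝ)) * ∑ i, (x i - g (f x) i)^2 ≤ d + F.indicator (fun _ => T) x + ((1/(n:ℝ)) * ∑ i, x i ^4) / T := by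
    intro x
    have h4 : 0 ≤ ((1/(n:ℝ)) * ∑ i, x i ^4) / T :=
      div_nonneg (mul_nonneg (by positivity) (Finset.sum_nonneg fun i _ => by positivity)) hT.le
    have hind : 0 ≤ F.indicator (fun _ => T) x := Set.indicator_nonneg (fun _ _ => hT.le) x
    have hspec := Nat.find_spec (hq x)
    rcases hspec with ⟨h, hle⟩ | hMc
    · have hg : g (f x) = y ⟨Nat.find (hq x), h⟩ := by
        simp only [g, hfv, h, dif_pos]
      rw [hg]
      have : (1/(n:ℝ)) * ∑ i, (x i - y ⟨Nat.find (hq x), h⟩ i)^2 ≤ (1/(n:ℝ)) * (n*d) :=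
        mul_le_mul_of_nonneg_left hle (by positivity)
      have e : (1/(n:ℝ)) * (n*d) = d := by field_simp
      linarith
    · have hg : g (f x) = 0 := by
        simp only [g, hfv, hMc, lt_irrefl, dif_neg, not_false_iff]
      have hxF : x ∈ F := by
        intro k hk
        have := Nat.find_min' (hq x) (m := k) (Or.inl ⟨k.2, hk⟩)
        have := k.2
        omega
      rw [hg, Set.indicator_of_mem hxF]
      simp only [Pi.zero_apply, sub_zero]
      have hcs := sq_sum_le_card_mul_sum_sq (s := Finset.univ) (f := fun i : Fin n => x i ^2)
      simp only [Finset.card_univ, Fintype.card_fin, ← pow_mul] at hcs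
      norm_num at hcs
      set S := ∑ i, x i^2
      set S4 := ∑ i, x i^4
      have h5 : (1/(n:ℝ) * S) ^2 ≤ 1/(n:ℝ) * S4 := by
        have : (1/(n:ℝ) * S)^2 = (1/(n:ℝ)^2) * S^2 := by field_simp
        rw [this]
        calc _ ≤ (1/(n:ℝ)^2) * (n * S4) := mul_le_mul_of_nonneg_left hcs (by positivity)
          _ = _ := by field_simp
      have h6 : 1/(n:ℝ) * S ≤ T + (1/(n:ℝ) * S4) / T := by
        rw [← sub_le_iff_le_add', le_div_iff₀ hT]
        nlinarith [sq_nonneg (1/(n:ℝ) * S - T), sq_nonneg (1/(n:ℝ)*S), sq_nonneg T]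
      linarith
  have j1 : Integrable (fun x => F.indicator (fun _ => T) x) μ := (integrable_const T).indicator hFm
  have j2 : Integrable (fun x : Fin n → ℝ => ((1/(n:ℝ)) * ∑ i, x i ^4) / T) μ :=
    ((integrable_finsetSum _ fun i _ => integrable_comp_eval (μ := fun _ : Fin n => gaussianReal 0 s.toNNReal) (i := i) i4).const_mul _).div_const _
  have j3 : Integrable (fun x => d + F.indicator (fun _ => T) x) μ := (integrable_const d).add j1
  have := integral_mono_of_nonneg (μ := μ) (f := fun x => (1/(n:ℝ)) * ∑ i, (x i - g (f x) i)^2)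
    (ae_of_all _ fun x => mul_nonneg (by positivity) (Finset.sum_nonneg fun i _ => sq_nonneg _)) (j3.add j2) (ae_of_all _ hpt)
  refine this.trans ?_
  have hev : ∀ i : Fin n, ∫ x : Fin n → ℝ, x i ^4 ∂μ = ∫ t, t^4 ∂(gaussianReal 0 s.toNNReal) := fun i =>
    integral_comp_eval (μ := fun _ : Fin n => gaussianReal 0 s.toNNReal) (i := i) i4.1
  have hie : ∀ i : Fin n, Integrable (fun x : Fin n → ℝ => x i ^4) μ := fun i =>
    integrable_comp_eval (μ := fun _ : Fin n => gaussianReal 0 s.toNNReal) (i := i) i4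
  have h4 : ∫ x : Fin n → ℝ, ((1/(n:ℝ)) * ∑ i, x i ^4) / T ∂μ = (∫ t, t^4 ∂(gaussianReal 0 s.toNNReal)) / T := by
    rw [integral_div, integral_const_mul, integral_finsetSum _ fun i _ => hie i,
      Finset.sum_congr rfl (fun i _ => hev i)]
    simp only [Finset.sum_const, Finset.card_univ, Fintype.card_fin, nsmul_eq_mul]
    field_simp
  rw [integral_add' j3 j2, integral_add (integrable_const d) j1, integral_indicator_const _ hFm, h4]
  simp only [integral_const, probReal_univ, smul_eq_mul, one_mul]
  nlinarith [mul_le_mul_of_nonneg_left hy hT.le]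

lemma scalar_code (s r ε : ℝ) (hs : 0 < s) (hr : 0 < r) (hε : 0 < ε) : ∀ᶠ n : ℕ in Filter.atTop,
    ∃ (M : ℕ) (f : (Fin n → ℝ) → Fin M) (g : Fin M → Fin n → ℝ), Measurable f ∧ (M:ℝ) ≤ Real.exp (n * (r + ε)) ∧
      ∫ x, (1/(n:ℝ)) * ∑ i, (x i - g (f x) i)^2 ∂(Measure.pi fun _ : Fin n => gaussianReal 0 s.toNNReal) ≤
        s * Real.exp (-(2*r)) + ε := by
  obtain ⟨K, hK⟩ := cover s r (ε/2) hs hr (by positivity)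
  set C4 := ∫ t, t^4 ∂(gaussianReal 0 s.toNNReal) with hC4
  have hC40 : 0 ≤ C4 := integral_nonneg fun t => by positivity
  set T := 4 * C4 / ε + 1 with hT
  have hTp : 0 < T := by positivity
  have hCT : C4 / T ≤ ε / 4 := by
    rw [div_le_iff₀ hTp, hT]
    have : ε / 4 * (4 * C4 / ε + 1) = C4 + ε/4 := by field_simp
    linarith
  have hlim : Filter.Tendsto (fun n : ℕ => T * (K / n + Real.exp (1 - n * (ε/2)))) Filter.atTop (nhds (T * (0 + 0))) := by
    refine Filter.Tendsto.const_mul _ (Filter.Tendsto.add (tendsto_const_div_atTop_nhds_zero_nat K) ?_)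
    refine Real.tendsto_exp_atBot.comp ?_
    have : Filter.Tendsto (fun n : ℕ => (n:ℝ) * (ε/2)) Filter.atTop Filter.atTop :=
      tendsto_natCast_atTop_atTop.atTop_mul_const (by positivity)
    exact Filter.tendsto_atBot_add_const_left _ 1 (Filter.tendsto_neg_atTop_atBot.comp this)
  have hev := hlim.eventually (gt_mem_nhds (show T * (0+0) < ε/4 by simpa using hε))
  filter_upwards [hev, Filter.eventually_ge_atTop 1] with n hn1 hn
  have hn' : (0:ℝ) < n := by exact_mod_cast hn
  set A := Real.exp (n * (r + ε)) with hA
  have hA1 : 1 ≤ A := Real.one_le_exp (by positivity)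
  have hfl : 1 ≤ ⌊A⌋₊ := (Nat.one_le_floor_iff _).2 hA1
  set Mc := ⌊A⌋₊ - 1 with hMc
  have hM1 : Mc + 1 = ⌊A⌋₊ := by omega
  have hMc' : A - 2 ≤ Mc := by
    have h1 := Nat.lt_floor_add_one A
    have h2 : ((Mc:ℝ)) + 1 = ⌊A⌋₊ := by exact_mod_cast hM1
    linarith
  obtain ⟨y, hy⟩ := hK n hn Mc
  obtain ⟨f, g, hf, hfg⟩ := code_of_cover s n Mc hn _ _ T hTp (by positivity) y hy
  refine ⟨Mc+1, f, g, hf, ?_, hfg.trans ?_⟩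
  · rw [hM1]; exact Nat.floor_le (by linarith)
  · have hγ1 : 1 ≤ Real.exp (n * (r + ε/2)) := Real.one_le_exp (by positivity)
    have hexp : Real.exp (-(Mc / Real.exp (n * (r + ε/2)))) ≤ Real.exp (1 - n * (ε/2)) := by
      apply Real.exp_le_exp.2
      have h1 : n * (ε/2) - 1 ≤ Mc / Real.exp (n * (r + ε/2)) := by
        rw [le_div_iff₀ (by positivity)]
        have e1 : A = Real.exp (n * (ε/2)) * Real.exp (n * (r + ε/2)) := by
          rw [hA, ← Real.exp_add]; congr 1; ring
        have e2 := Real.add_one_le_exp (n * (ε/2))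
        nlinarith
      linarith
    have : T * (K / n + Real.exp (-(Mc / Real.exp (n * (r + ε/2))))) ≤ T * (K / n + Real.exp (1 - n * (ε/2))) :=
      mul_le_mul_of_nonneg_left (by linarith) hTp.le
    linarith

lemma achiev (l : ℕ) (hl : 1 ≤ l) (m σ : Fin l → ℝ) (hσ : ∀ j, 0 < σ j) (R : ℝ) (ρ : Fin l → ℝ)
    (hρ : ∀ j, 0 ≤ ρ j) (hρR : ∑ j, ρ j ≤ R) :
    VecIsAchievable l (Measure.pi fun j => gaussianReal (m j) (Real.toNNReal ((σ j) ^ 2))) R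
      (∑ j, (σ j) ^ 2 * 2 ^ (-(2 * ρ j))) := by
  intro ε hε
  have hl' : (0:ℝ) < l := by exact_mod_cast hl
  have hlog : 0 < Real.log 2 := Real.log_pos (by norm_num)
  have hlog1 : Real.log 2 < 1 := by have := Real.log_two_lt_d9; linarith
  set ε' := ε * Real.log 2 / (2 * l) with hε'
  have hε'p : 0 < ε' := by positivity
  let r : Fin l → ℝ := fun j => (ρ j + ε / (2*l)) * Real.log 2
  have hr : ∀ j, 0 < r j := fun j => mul_pos (add_pos_of_nonneg_of_pos (hρ j) (by positivity)) hlog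
  have hev : ∀ᶠ n : ℕ in Filter.atTop, ∀ j, ∃ (M : ℕ) (f : (Fin n → ℝ) → Fin M) (g : Fin M → Fin n → ℝ), Measurable f ∧ (M:ℝ) ≤ Real.exp (n * (r j + ε')) ∧
      ∫ x, (1/(n:ℝ)) * ∑ i, (x i - g (f x) i)^2 ∂(Measure.pi fun _ : Fin n => gaussianReal 0 (Real.toNNReal (σ j ^2))) ≤
        σ j ^2 * Real.exp (-(2*r j)) + ε' :=
    Filter.eventually_all.2 fun j => scalar_code (σ j ^2) (r j) ε' (pow_pos (hσ j) 2) (hr j) hε'p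
  obtain ⟨n, hcode, hn⟩ := (hev.and (Filter.eventually_ge_atTop 1)).exists
  have hn' : (0:ℝ) < n := by exact_mod_cast hn
  choose M f g hf hM hD using hcode
  let e : ((j : Fin l) → Fin (M j)) ≃ Fin (∏ j, M j) := finPiFinEquiv
  let π : Fin l → (Fin n → Fin l → ℝ) → Fin n → ℝ := fun j x i => x i j - m j
  have hπ : ∀ j, Measurable (π j) := fun j => by fun_prop
  refine ⟨n, ∏ j, M j, fun x => e fun j => f j (π j x), fun k i j => m j + g j (e.symm k j) i, hn, ?_, ?_, ?_⟩
  · exact (measurable_of_finite e).comp (measurable_pi_lambda _ fun j => (hf j).comp (hπ j))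
  · push_cast
    calc ∏ j, (M j : ℝ) ≤ ∏ j, Real.exp (n * (r j + ε')) := Finset.prod_le_prod (fun j _ => Nat.cast_nonneg _) fun j _ => hM j
      _ = Real.exp (∑ j, n * (r j + ε')) := (Real.exp_sum _ _).symm
      _ ≤ 2 ^ ((n : ℝ) * (R + ε)) := by
        rw [Real.rpow_def_of_pos (by norm_num)]
        apply Real.exp_le_exp.2
        rw [← Finset.mul_sum]
        have : ∑ j, (r j + ε') = (∑ j, ρ j + ε) * Real.log 2 := by
          simp only [r, Finset.sum_add_distrib, ← Finset.sum_mul]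
          simp [hε']
          field_simp
          ring
        rw [this, ← mul_assoc, mul_comm (Real.log 2), mul_assoc, mul_assoc]
        refine mul_le_mul_of_nonneg_left (mul_le_mul_of_nonneg_right (by linarith) hlog.le) hn'.le
  · unfold vecExpectedDistortion
    let Φ : (j : Fin l) → (Fin n → ℝ) → ℝ := fun j u => (1/(n:ℝ)) * ∑ i, (u i - g j (f j u) i)^2
    have hΦ : ∀ j, Integrable (Φ j) (Measure.pi fun _ : Fin n => gaussianReal 0 (Real.toNNReal (σ j ^2))) := by
      intro j
      refine (integrable_finsetSum _ fun i _ => ?_).const_mul _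
      have hb : Integrable (fun x : Fin n → ℝ => ∑ k, (x i - g j k i)^2) (Measure.pi fun _ : Fin n => gaussianReal 0 (Real.toNNReal (σ j ^2))) :=
        integrable_finsetSum _ fun k _ => integrable_comp_eval (μ := fun _ : Fin n => gaussianReal 0 (Real.toNNReal (σ j ^2))) (i := i)
          (f := fun t => (t - g j k i)^2) (int_sq_gauss _ _ _)
      have hgm : Measurable fun x => g j (f j x) i := (measurable_from_top (f := fun k => g j k i)).comp (hf j)
      refine hb.mono' (((measurable_pi_apply i).sub hgm).pow_const 2).aestronglyMeasurable (ae_of_all _ fun x => ?_)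
      rw [Real.norm_of_nonneg (sq_nonneg _)]
      exact Finset.single_le_sum (f := fun k => (x i - g j k i)^2) (fun k _ => sq_nonneg _) (Finset.mem_univ (f j x))
    have hmp : ∀ j, MeasurePreserving (π j) (Measure.pi fun _ : Fin n => Measure.pi fun j => gaussianReal (m j) (Real.toNNReal ((σ j) ^ 2)))
        (Measure.pi fun _ : Fin n => gaussianReal 0 (Real.toNNReal (σ j ^2))) := by
      intro j
      refine ⟨hπ j, ?_⟩
      have h1 : (Measure.pi fun j => gaussianReal (m j) (Real.toNNReal ((σ j) ^ 2))).map (fun x => x j - m j) = gaussianReal 0 (Real.toNNReal (σ j ^2)) := by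
        have h2 := (measurePreserving_eval (fun j => gaussianReal (m j) (Real.toNNReal ((σ j) ^ 2))) j).map_eq
        have h3 := gaussianReal_map_sub_const (μ := m j) (v := Real.toNNReal ((σ j) ^ 2)) (m j)
        rw [← h2, Measure.map_map (by fun_prop) (by fun_prop), sub_self] at h3
        exact h3
      have : ∀ i : Fin n, SigmaFinite ((Measure.pi fun j => gaussianReal (m j) (Real.toNNReal ((σ j) ^ 2))).map (fun x : Fin l → ℝ => x j - m j)) := fun i => by
        rw [h1]; infer_instance
      have h4 := Measure.pi_map_pi (μ := fun _ : Fin n => Measure.pi fun j => gaussianReal (m j) (Real.toNNReal ((σ j) ^ 2)))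
        (f := fun _ x => x j - m j) (fun i => ((measurable_pi_apply j).sub_const _).aemeasurable)
      simp only [h1] at h4
      exact h4
    have hpt : ∀ x : Fin n → Fin l → ℝ, (1 / (n : ℝ)) * ∑ i, ∑ j, (x i j - (m j + g j (e.symm (e fun j => f j (π j x)) j) i)) ^ 2 = ∑ j, Φ j (π j x) := by
      intro x
      simp only [Φ, Equiv.symm_apply_apply, ← Finset.mul_sum]
      rw [Finset.sum_comm]
      congr 1
      refine Finset.sum_congr rfl fun j _ => Finset.sum_congr rfl fun i _ => ?_
      simp only [π]
      ring
    simp only [hpt]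
    have hint : ∀ j, Integrable (fun x => Φ j (π j x)) (Measure.pi fun _ : Fin n => Measure.pi fun j => gaussianReal (m j) (Real.toNNReal ((σ j) ^ 2))) :=
      fun j => (hmp j).integrable_comp_of_integrable (hΦ j)
    rw [integral_finsetSum _ fun j _ => hint j]
    have hval : ∀ j, ∫ x, Φ j (π j x) ∂(Measure.pi fun _ : Fin n => Measure.pi fun j => gaussianReal (m j) (Real.toNNReal ((σ j) ^ 2))) ≤ σ j ^2 * 2 ^ (-(2 * ρ j)) + ε' := by
      intro j
      have h1 := integral_map (hπ j).aemeasurable (by rw [(hmp j).map_eq]; exact (hΦ j).1)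
      rw [(hmp j).map_eq] at h1
      rw [← h1]
      refine (hD j).trans ?_
      have h2 : Real.exp (-(2 * r j)) ≤ 2 ^ (-(2 * ρ j)) := by
        rw [Real.rpow_def_of_pos (by norm_num)]
        apply Real.exp_le_exp.2
        have : ρ j * Real.log 2 ≤ r j := mul_le_mul_of_nonneg_right (by have : 0 < ε / (2*l) := by positivity
                                                                        linarith) hlog.le
        nlinarith
      have := mul_le_mul_of_nonneg_left h2 (sq_nonneg (σ j))
      linarith
    refine (Finset.sum_le_sum fun j _ => hval j).trans ?_
    rw [Finset.sum_add_distrib]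
    have : ∑ j : Fin l, ε' ≤ ε := by
      simp [hε']
      field_simp
      linarith
    linarith

lemma exists_theta (l : ℕ) (hl : 1 ≤ l) (σ : Fin l → ℝ) (hσ : ∀ j, 0 < σ j) (R : ℝ) (hR : 0 ≤ R) :
    ∃ θ : ℝ, 0 < θ ∧ ∑ j, (1/2) * Real.log (max (σ j ^2) θ / θ) = R := by
  let j0 : Fin l := ⟨0, hl⟩
  set a := σ j0 ^2 * Real.exp (-(2*R)) with ha
  set b := ∑ j, σ j ^2 with hb
  have hs : ∀ j, 0 < σ j ^2 := fun j => pow_pos (hσ j) 2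
  have hap : 0 < a := mul_pos (hs _) (Real.exp_pos _)
  have hsb : ∀ j, σ j ^2 ≤ b := fun j => Finset.single_le_sum (f := fun j => σ j ^2) (fun j _ => (hs j).le) (Finset.mem_univ j)
  have hbp : 0 < b := (hs j0).trans_le (hsb j0)
  have haσ : a ≤ σ j0 ^2 := by
    have : Real.exp (-(2*R)) ≤ 1 := Real.exp_le_one_iff.2 (by linarith)
    have := mul_le_mul_of_nonneg_left this (hs j0).le
    linarith
  have hab : a ≤ b := haσ.trans (hsb j0)
  let h : ℝ → ℝ := fun θ => ∑ j, (1/2) * Real.log (max (σ j ^2) θ / θ)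
  have hcont : ContinuousOn h (Set.Icc a b) := by
    refine continuousOn_finsetSum _ fun j _ => ContinuousOn.mul continuousOn_const (ContinuousOn.log (ContinuousOn.div (by fun_prop) continuousOn_id ?_) ?_)
    · intro x hx; exact (hap.trans_le hx.1).ne'
    · intro x hx
      have hx0 : 0 < x := hap.trans_le hx.1
      exact (div_pos (lt_max_of_lt_right hx0) hx0).ne'
  have hbz : h b = 0 := by
    refine Finset.sum_eq_zero fun j _ => ?_
    rw [max_eq_right (hsb j), div_self hbp.ne']; simp
  have haR : R ≤ h a := by
    have h0 : ∀ j, 0 ≤ (1/2) * Real.log (max (σ j ^2) a / a) := fun j =>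
      mul_nonneg (by norm_num) (Real.log_nonneg ((one_le_div hap).2 (le_max_right _ _)))
    have h1 : (1/2) * Real.log (max (σ j0 ^2) a / a) = R := by
      rw [max_eq_left haσ, ha]
      have : σ j0 ^2 / (σ j0 ^2 * Real.exp (-(2*R))) = Real.exp (2*R) := by
        rw [Real.exp_neg]
        have := (hσ j0).ne'
        field_simp
      rw [this, Real.log_exp]; ring
    calc R = (1/2) * Real.log (max (σ j0 ^2) a / a) := h1.symm
      _ ≤ h a := Finset.single_le_sum (f := fun j => (1/2) * Real.log (max (σ j ^2) a / a)) (fun j _ => h0 j) (Finset.mem_univ j0)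
  obtain ⟨θ, hθ, hθR⟩ := intermediate_value_Icc' hab hcont ⟨hbz.le.trans hR, haR⟩
  exact ⟨θ, hap.trans_le hθ.1, hθR⟩

/-- Theorem 2 of the paper: the distortion-rate function of a Gaussian memoryless
vector source with independent components equals the optimal value of the
bit-allocation optimization problem. -/
theorem gaussian_vector_distortion_rate_function
    (l : ℕ) (hl : 1 ≤ l) (m σ : Fin l → ℝ) (hσ : ∀ j, 0 < σ j)
    (ν : Measure (Fin l → ℝ))
    (hν : ν = Measure.pi fun j => gaussianReal (m j) (Real.toNNReal ((σ j) ^ 2)))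
    (R : ℝ) (hR : 0 ≤ R) :
    sInf {D : ℝ | 0 ≤ D ∧ VecIsAchievable l ν R D} = bitAllocationValue l σ R := by
  subst hν
  have hlog : 0 < Real.log 2 := Real.log_pos (by norm_num)
  have hpos : ∀ ρ : Fin l → ℝ, 0 ≤ ∑ j, (σ j) ^ 2 * (2:ℝ) ^ (-(2 * ρ j)) := fun ρ =>
    Finset.sum_nonneg fun j _ => by positivity
  have hmem : ∀ ρ : Fin l → ℝ, (∀ j, 0 ≤ ρ j) → ∑ j, ρ j ≤ R → (∑ j, (σ j) ^ 2 * (2:ℝ) ^ (-(2 * ρ j))) ∈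
      {D : ℝ | 0 ≤ D ∧ VecIsAchievable l (Measure.pi fun j => gaussianReal (m j) (Real.toNNReal ((σ j) ^ 2))) R D} :=
    fun ρ h1 h2 => ⟨hpos ρ, achiev l hl m σ hσ R ρ h1 h2⟩
  have hbdd : BddBelow {D : ℝ | 0 ≤ D ∧ VecIsAchievable l (Measure.pi fun j => gaussianReal (m j) (Real.toNNReal ((σ j) ^ 2))) R D} :=
    ⟨0, fun D hD => hD.1⟩
  apply le_antisymm
  · unfold bitAllocationValue
    refine le_csInf ⟨_, 0, fun j => le_rfl, by simpa using hR, rfl⟩ ?_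
    rintro d ⟨ρ, h1, h2, rfl⟩
    exact csInf_le hbdd (hmem ρ h1 h2)
  · refine le_csInf ⟨_, hmem 0 (fun j => le_rfl) (by simpa using hR)⟩ ?_
    rintro D ⟨hD0, hD⟩
    obtain ⟨θ, hθ, hθR⟩ := exists_theta l hl σ hσ (R * Real.log 2) (by positivity)
    have hs : ∀ j, 0 < σ j ^2 := fun j => pow_pos (hσ j) 2
    have hτ : ∀ j, 0 < max (σ j ^2) θ := fun j => lt_max_of_lt_right hθ
    let ρ : Fin l → ℝ := fun j => (1/2) * Real.log (max (σ j ^2) θ / θ) / Real.log 2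
    have hρ0 : ∀ j, 0 ≤ ρ j := fun j =>
      div_nonneg (mul_nonneg (by norm_num) (Real.log_nonneg ((one_le_div hθ).2 (le_max_right _ _)))) hlog.le
    have hρR : ∑ j, ρ j = R := by
      simp only [ρ, ← Finset.sum_div]
      rw [hθR]; field_simp
    have hval : ∀ j, σ j ^2 * (2:ℝ) ^ (-(2 * ρ j)) = 2 * θ * (σ j ^2 / (2 * max (σ j ^2) θ)) := by
      intro j
      have : (2:ℝ) ^ (-(2 * ρ j)) = θ / max (σ j ^2) θ := by
        rw [Real.rpow_def_of_pos (by norm_num)]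
        have : Real.log 2 * (-(2 * ρ j)) = - Real.log (max (σ j ^2) θ / θ) := by
          simp only [ρ]; field_simp
        rw [this, Real.exp_neg, Real.exp_log (div_pos (hτ j) hθ), inv_div]
      rw [this]
      have := (hτ j).ne'
      field_simp
    have hle : bitAllocationValue l σ R ≤ ∑ j, (σ j) ^ 2 * (2:ℝ) ^ (-(2 * ρ j)) := by
      unfold bitAllocationValue
      refine csInf_le ⟨0, ?_⟩ ⟨ρ, hρ0, hρR.le, rfl⟩
      rintro d ⟨ρ', _, _, rfl⟩
      exact hpos ρ'
    refine hle.trans ?_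
    simp only [hval, ← Finset.mul_sum]
    set S := ∑ j, σ j ^2 / (2 * max (σ j ^2) θ) with hS
    have key : ∀ ε > 0, 2 * θ * S ≤ D + ε * (1 + 2 * θ * Real.log 2) := by
      intro ε hε
      obtain ⟨n, M, f, g, hn, hf, hM, hdist⟩ := hD ε hε
      have hn' : (0:ℝ) < n := by exact_mod_cast hn
      have hMp : 0 < M := (f (fun _ _ => 0)).pos
      have hb := conv_bound l n M hn m σ hσ θ hθ f g hf
      rw [Finset.sum_add_distrib, hθR, ← hS] at hb
      have hlM : Real.log M ≤ n * ((R + ε) * Real.log 2) := by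
        have := Real.log_le_log (by exact_mod_cast hMp) hM
        rw [Real.log_rpow (by norm_num)] at this
        linarith
      have h1 := le_of_mul_le_mul_left (hb.trans hlM) hn'
      set d := vecExpectedDistortion l n M (Measure.pi fun j => gaussianReal (m j) (Real.toNNReal ((σ j) ^ 2))) f g
      have h2 : S - ε * Real.log 2 ≤ d / (2*θ) := by linarith
      rw [le_div_iff₀ (by positivity)] at h2
      nlinarith
    refine le_of_forall_pos_le_add fun η hη => ?_
    have hc : 0 < 1 + 2 * θ * Real.log 2 := by positivity
    have := key (η / (1 + 2 * θ * Real.log 2)) (by positivity)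
    rwa [div_mul_cancel₀ _ hc.ne'] at this
end

section
/- (Reverse water-filling solution of the bit-allocation problem.) Let l ≥ 1, σ_1, …, σ_l > 0, and R > 0. Then the minimum of Σ_{j=1}^l σ_j² · 2^(−2ρ_j) over all ρ ∈ ℝˡ with ρ_j ≥ 0 for all j and Σ_{j=1}^l ρ_j ≤ R is attained, and there exists λ with 0 < λ < max_j σ_j² such that the vector ρ* defined by ρ*_j = max(0, (1/2) · log₂(σ_j²/λ)) satisfies Σ_{j=1}^l ρ*_j = R and is a minimizer; moreover the minimum value equals Σ_{j=1}^l min(λ, σ_j²). -/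
/-- Reverse water-filling solution of the bit-allocation problem: for `R > 0` there is
a water level `λ` with `0 < λ < maxⱼ σⱼ²` such that `ρ*ⱼ = max 0 ((1/2) log₂(σⱼ²/λ))`
uses exactly `R` bits, minimizes `∑ⱼ σⱼ² 2^(-2ρⱼ)` over the feasible set
`{ρ : ρ ≥ 0, ∑ⱼ ρⱼ ≤ R}`, and achieves the value `∑ⱼ min λ σⱼ²`. -/
theorem reverse_water_filling
    (l : ℕ) (hl : 1 ≤ l) (σ : Fin l → ℝ) (hσ : ∀ j, 0 < σ j)
    (R : ℝ) (hR : 0 < R) :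
    ∃ lam : ℝ, 0 < lam ∧ (∃ j, lam < (σ j) ^ 2) ∧
      ∃ ρstar : Fin l → ℝ,
        (∀ j, ρstar j = max 0 ((1 / 2) * Real.logb 2 ((σ j) ^ 2 / lam))) ∧
        (∑ j, ρstar j) = R ∧
        (∀ j, 0 ≤ ρstar j) ∧
        (∀ ρ : Fin l → ℝ, (∀ j, 0 ≤ ρ j) → (∑ j, ρ j) ≤ R →
          ∑ j, (σ j) ^ 2 * 2 ^ (-(2 * ρstar j)) ≤ ∑ j, (σ j) ^ 2 * 2 ^ (-(2 * ρ j))) ∧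
        (∑ j, (σ j) ^ 2 * 2 ^ (-(2 * ρstar j))) = ∑ j, min lam ((σ j) ^ 2) := by
  classical
  have hs : ∀ j, 0 < (σ j) ^ 2 := fun j => pow_pos (hσ j) 2
  obtain ⟨a, ha⟩ : ∃ a : Fin l → ℝ, ∀ j, a j = (1 / 2) * Real.logb 2 ((σ j) ^ 2) :=
    ⟨_, fun _ => rfl⟩
  have hpow : ∀ j, (σ j) ^ 2 = (2 : ℝ) ^ (2 * a j) := by
    intro j
    have h : 2 * a j = Real.logb 2 ((σ j) ^ 2) := by rw [ha]; ring
    rw [h, Real.rpow_logb (by norm_num) (by norm_num) (hs j)]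
  obtain ⟨t, ht⟩ : ∃ t : ℝ, ∑ j, max 0 (a j + t) = R := by
    have hc : Continuous (fun t : ℝ => ∑ j, max 0 (a j + t)) := by fun_prop
    have := mem_range_of_exists_le_of_exists_ge (c := R) hc ?_ ?_
    · exact this
    · refine ⟨-∑ j, |a j|, ?_⟩
      have : ∑ j, max 0 (a j + -∑ j, |a j|) = 0 := by
        apply Finset.sum_eq_zero
        intro j _
        apply max_eq_left
        have h1 := Finset.single_le_sum (f := fun j => |a j|) (fun i _ => abs_nonneg (a i))
          (Finset.mem_univ j)
        have h2 := le_abs_self (a j)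
        linarith
      simp only [this]
      exact hR.le
    · refine ⟨R - a ⟨0, hl⟩, ?_⟩
      have h1 := Finset.single_le_sum (f := fun j => max 0 (a j + (R - a ⟨0, hl⟩)))
        (fun i _ => le_max_left _ _) (Finset.mem_univ ⟨0, hl⟩)
      refine le_trans ?_ h1
      refine le_trans ?_ (le_max_right _ _)
      linarith
  have hlam : 0 < (2 : ℝ) ^ (-(2 * t)) := by positivity
  have hD : ∀ j, (σ j) ^ 2 * 2 ^ (-(2 * max 0 (a j + t)))
      = min ((2 : ℝ) ^ (-(2 * t))) ((σ j) ^ 2) := by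
    intro j
    rw [hpow, ← Real.rpow_add (by norm_num)]
    rcases le_total 0 (a j + t) with h | h
    · rw [max_eq_right h, min_eq_left]
      · congr 1; ring
      · apply Real.rpow_le_rpow_of_exponent_le (by norm_num); linarith
    · rw [max_eq_left h, min_eq_right]
      · congr 1; ring
      · apply Real.rpow_le_rpow_of_exponent_le (by norm_num); linarith
  refine ⟨(2 : ℝ) ^ (-(2 * t)), hlam, ?_, fun j => max 0 (a j + t), ?_, ht,
    fun j => le_max_left _ _, ?_, Finset.sum_congr rfl fun j _ => hD j⟩
  · by_contra! hcon
    have : ∑ j, max 0 (a j + t) = 0 := by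
      apply Finset.sum_eq_zero
      intro j _
      apply max_eq_left
      have h := hcon j
      rw [hpow, Real.rpow_le_rpow_left_iff (by norm_num)] at h
      linarith
    linarith
  · intro j
    rw [Real.logb_div (hs j).ne' hlam.ne', Real.logb_rpow (by norm_num) (by norm_num)]
    simp only [ha]
    congr 1
    ring
  · intro ρ hρ hsum
    have hl2 : 0 < Real.log 2 := Real.log_pos (by norm_num)
    have key : ∀ j, (σ j) ^ 2 * 2 ^ (-(2 * max 0 (a j + t)))
        - (2 : ℝ) ^ (-(2 * t)) * (2 * Real.log 2) * (ρ j - max 0 (a j + t))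
        ≤ (σ j) ^ 2 * 2 ^ (-(2 * ρ j)) := by
      intro j
      have hsplit : (σ j) ^ 2 * (2 : ℝ) ^ (-(2 * ρ j))
          = (σ j) ^ 2 * 2 ^ (-(2 * max 0 (a j + t)))
            * 2 ^ (-(2 * (ρ j - max 0 (a j + t)))) := by
        rw [mul_assoc, ← Real.rpow_add (by norm_num)]
        congr 2; ring
      have hexp : 1 - 2 * Real.log 2 * (ρ j - max 0 (a j + t))
          ≤ (2 : ℝ) ^ (-(2 * (ρ j - max 0 (a j + t)))) := by
        rw [Real.rpow_def_of_pos (by norm_num)]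
        have := Real.add_one_le_exp (Real.log 2 * -(2 * (ρ j - max 0 (a j + t))))
        linarith
      have hDpos : 0 < (σ j) ^ 2 * (2 : ℝ) ^ (-(2 * max 0 (a j + t))) :=
        mul_pos (hs j) (by positivity)
      rw [hsplit]
      have h1 := mul_le_mul_of_nonneg_left hexp hDpos.le
      refine le_trans ?_ h1
      rcases le_total 0 (a j + t) with h | h
      · have : (σ j) ^ 2 * (2 : ℝ) ^ (-(2 * max 0 (a j + t))) = 2 ^ (-(2 * t)) := by
          rw [hpow, ← Real.rpow_add (by norm_num), max_eq_right h]
          congr 1; ring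
        rw [this]
        apply le_of_eq; ring
      · have hle : (σ j) ^ 2 * (2 : ℝ) ^ (-(2 * max 0 (a j + t))) ≤ 2 ^ (-(2 * t)) := by
          rw [hD]; exact min_le_left _ _
        have hnn : 0 ≤ 2 * Real.log 2 * (ρ j - max 0 (a j + t)) := by
          rw [max_eq_left h]
          have := hρ j
          simp only [sub_zero]
          positivity
        have := mul_le_mul_of_nonneg_right hle hnn
        linarith
    have hS := Finset.sum_le_sum (fun j (_ : j ∈ Finset.univ) => key j)
    rw [Finset.sum_sub_distrib, ← Finset.mul_sum, Finset.sum_sub_distrib, ht] at hS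
    have : (2 : ℝ) ^ (-(2 * t)) * (2 * Real.log 2) * (∑ j, ρ j - R) ≤ 0 :=
      mul_nonpos_of_nonneg_of_nonpos (by positivity) (by linarith)
    linarith
end
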